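/- Every moving phantom mechanism satisfies monotonicity: for every phantom system F, every preference profile P, every voter i, and all budget divisions p_i, p'_i such that p_{i,j} > p'_{i,j} for some alternative j and p_{i,k} ≤ p'_{i,k} for all k ≠ j, it holds that A^F(p_i, P_{-i})_j ≥ A^F(p'_i, P_{-i})_j. -/

import Mathlib

open Finset

/-- `p` is a budget division over `m` alternatives: entries in `[0,1]` summing to `1`. -/
def IsDivision {m : ℕ} (p : Fin m → ℝ) : Prop :=
  (∀ j, p j ∈ Set.Icc (0 : ℝ) 1) ∧ ∑ j, p j = 1

/-- A valid preference profile: every voter reports a budget division. -/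
def IsProfile {n m : ℕ} (P : Fin n → Fin m → ℝ) : Prop :=
  ∀ i, IsDivision (P i)

/-- The ℓ1 distance between two vectors. -/
noncomputable def l1 {m : ℕ} (x y : Fin m → ℝ) : ℝ := ∑ j, |x j - y j|

/-- Median of a list of odd length `2k+1`: its `(k+1)`-st smallest element. -/
noncomputable def medList (l : List ℝ) : ℝ :=
  ((Multiset.ofList l).sort (· ≤ ·)).getD ((l.length - 1) / 2) 0

/-- Coordinate-wise generalized median on alternative `j`, with phantoms `f k t` and
the voters' reports on alternative `j`. -/
noncomputable def phMed {n m : ℕ} (f : Fin (n + 1) → ℝ → ℝ)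
    (P : Fin n → Fin m → ℝ) (t : ℝ) (j : Fin m) : ℝ :=
  medList (List.ofFn (fun k => f k t) ++ List.ofFn (fun i => P i j))

/-- A phantom system for `n` voters: `n+1` continuous, weakly increasing functions
`[0,1] → [0,1]` with `f k 0 = 0`, `f k 1 = 1`, ordered `f 0 ≥ f 1 ≥ ⋯ ≥ f n`. -/
structure IsPhantomSystem (n : ℕ) (f : Fin (n + 1) → ℝ → ℝ) : Prop where
  cont : ∀ k, ContinuousOn (f k) (Set.Icc 0 1)
  mono : ∀ k, MonotoneOn (f k) (Set.Icc 0 1)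
  mem_Icc : ∀ k, ∀ t ∈ Set.Icc (0 : ℝ) 1, f k t ∈ Set.Icc (0 : ℝ) 1
  apply_zero : ∀ k, f k 0 = 0
  apply_one : ∀ k, f k 1 = 1
  ordered : ∀ t ∈ Set.Icc (0 : ℝ) 1, ∀ k l : Fin (n + 1), k ≤ l → f l t ≤ f k t

/-- The normalizing time `t*` at which the coordinate-wise medians sum to `1`. -/
noncomputable def tStar {n m : ℕ} (f : Fin (n + 1) → ℝ → ℝ)
    (P : Fin n → Fin m → ℝ) : ℝ :=
  sInf {t | t ∈ Set.Icc (0 : ℝ) 1 ∧ ∑ j, phMed f P t j = 1}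

/-- The moving phantom mechanism `A^F` defined by the phantom family `f`. -/
noncomputable def AMP {n m : ℕ} (f : Fin (n + 1) → ℝ → ℝ)
    (P : Fin n → Fin m → ℝ) : Fin m → ℝ :=
  fun j => phMed f P (tStar f P) j

/-- The independent-markets phantom system for `n` voters: `f k t = min (t(n-k)) 1`. -/
noncomputable def fIM (n : ℕ) : Fin (n + 1) → ℝ → ℝ :=
  fun k t => min (t * ((n : ℝ) - (k : ℝ))) 1

/-- The phantom system `F*` for `n` voters, in which the phantoms move to 1 one at a time. -/
noncomputable def fStar (n : ℕ) : Fin (n + 1) → ℝ → ℝ :=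
  fun k t => max 0 (min 1 (t * ((n : ℝ) + 1) - (k : ℝ)))

/-- The `j`-th standard unit vector in `ℝ^m`. -/
def unitVec (m : ℕ) (j : Fin m) : Fin m → ℝ := fun k => if k = j then 1 else 0

/-- Incentive compatibility under ℓ1 preferences. -/
def IncentiveCompatible {n m : ℕ} (A : (Fin n → Fin m → ℝ) → (Fin m → ℝ)) : Prop :=
  ∀ P : Fin n → Fin m → ℝ, IsProfile P → ∀ i : Fin n,
    ∀ ptrue pmis : Fin m → ℝ, IsDivision ptrue → IsDivision pmis →
      l1 (A (Function.update P i ptrue)) ptrue ≤ l1 (A (Function.update P i pmis)) ptrue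

/-- Anonymity: the output is invariant under permutations of the voters. -/
def Anonymous {n m : ℕ} (A : (Fin n → Fin m → ℝ) → (Fin m → ℝ)) : Prop :=
  ∀ P : Fin n → Fin m → ℝ, IsProfile P → ∀ σ : Equiv.Perm (Fin n), A (P ∘ σ) = A P

/-- Neutrality: permuting the alternatives in all reports permutes the output likewise. -/
def Neutral {n m : ℕ} (A : (Fin n → Fin m → ℝ) → (Fin m → ℝ)) : Prop :=
  ∀ P : Fin n → Fin m → ℝ, IsProfile P → ∀ σ : Equiv.Perm (Fin m),
    A (fun i j => P i (σ j)) = fun j => A P (σ j)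

/-- Proportionality: on single-minded profiles, alternative `j` gets `n_j / n`. -/
def Proportional {n m : ℕ} (A : (Fin n → Fin m → ℝ) → (Fin m → ℝ)) : Prop :=
  ∀ P : Fin n → Fin m → ℝ, (∀ i, ∃ j, P i = unitVec m j) →
    ∀ j, A P j = (Nat.card {i : Fin n // P i = unitVec m j} : ℝ) / (n : ℝ)

/-- Pareto optimality. -/
def ParetoOptimal {n m : ℕ} (A : (Fin n → Fin m → ℝ) → (Fin m → ℝ)) : Prop :=
  ∀ P : Fin n → Fin m → ℝ, IsProfile P → ∀ q : Fin m → ℝ, IsDivision q →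
    (∃ i, l1 q (P i) < l1 (A P) (P i)) → ∃ i, l1 (A P) (P i) < l1 q (P i)

/-- A mechanism is valid if it maps profiles to budget divisions. -/
def ValidMech {n m : ℕ} (A : (Fin n → Fin m → ℝ) → (Fin m → ℝ)) : Prop :=
  ∀ P, IsProfile P → IsDivision (A P)

/-- `q` maximizes (utilitarian) social welfare for `P`, i.e. minimizes total ℓ1 distance. -/
def MaximizesWelfare {n m : ℕ} (P : Fin n → Fin m → ℝ) (q : Fin m → ℝ) : Prop :=
  IsDivision q ∧ ∀ q' : Fin m → ℝ, IsDivision q' → ∑ i, l1 (P i) q ≤ ∑ i, l1 (P i) q'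

/-- The `k`-th largest entry of `v` (1-indexed); `0` when `k > n`. -/
noncomputable def kthLargest {n : ℕ} (v : Fin n → ℝ) (k : ℕ) : ℝ :=
  (((Multiset.ofList (List.ofFn v)).sort (· ≤ ·)).reverse).getD (k - 1) 0

theorem aux_getD (c : ℝ) : ∀ (s : List ℝ), s.Pairwise (· ≤ ·) → ∀ k, k < s.length →
    (s.getD k 0 ≤ c ↔ k < s.countP (fun x => decide (x ≤ c))) := by
  intro s
  induction s with
  | nil => intro _ k hk; simp at hk
  | cons a s ih =>
    intro hs k hk
    rw [List.pairwise_cons] at hs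
    obtain ⟨h1, h2⟩ := hs
    by_cases hac : a ≤ c
    · rw [List.countP_cons_of_pos (by simpa using hac)]
      cases k with
      | zero => simp [hac]
      | succ k =>
        have := ih h2 k (by simpa using hk)
        simp only [List.getD_cons_succ]
        rw [this]; omega
    · have h0 : (a :: s).countP (fun x => decide (x ≤ c)) = 0 := by
        rw [List.countP_eq_zero]
        intro x hx
        rcases List.mem_cons.1 hx with rfl | hx
        · simpa using hac
        · have := h1 x hx
          simp only [decide_eq_true_eq]
          intro h
          exact hac (this.trans h)
      rw [h0]
      simp only [not_lt_zero, iff_false]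
      intro h
      have hm : (a :: s).getD k 0 ∈ a :: s := by
        rw [List.getD_eq_getElem _ _ hk]; exact List.getElem_mem hk
      rcases List.mem_cons.1 hm with h' | h'
      · rw [h'] at h; exact hac h
      · exact hac ((h1 _ h').trans h)

theorem aux_med (l : List ℝ) (hl : l ≠ []) (c : ℝ) :
    medList l ≤ c ↔ (l.length - 1) / 2 < l.countP (fun x => decide (x ≤ c)) := by
  have hpos : 0 < l.length := List.length_pos_iff.2 hl
  unfold medList
  rw [aux_getD c _ (Multiset.pairwise_sort _ _) _ (by
    rw [Multiset.length_sort, Multiset.coe_card]; omega)]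
  have hp : List.Perm ((Multiset.ofList l).sort (· ≤ ·)) l := by
    rw [← Multiset.coe_eq_coe, Multiset.sort_eq]
  rw [hp.countP_eq]

theorem aux_count (ε c : ℝ) {a b : List ℝ} (h : List.Forall₂ (fun x y => x ≤ y + ε) a b) :
    b.countP (fun x => decide (x ≤ c)) ≤ a.countP (fun x => decide (x ≤ c + ε)) := by
  induction h with
  | nil => simp
  | @cons x y a b hxy _ ih =>
    rw [List.countP_cons, List.countP_cons]
    by_cases hy : y ≤ c
    · have : x ≤ c + ε := by linarith
      simp [hy, this, ih]
    · simp only [hy, decide_false]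
      simp
      omega

theorem aux_med_le (ε : ℝ) {a b : List ℝ} (h : List.Forall₂ (fun x y => x ≤ y + ε) a b)
    (ha : a ≠ []) : medList a ≤ medList b + ε := by
  have hlen := h.length_eq
  have hb : b ≠ [] := by
    rintro rfl
    simp at hlen
    exact ha hlen
  rw [aux_med a ha]
  have h1 := (aux_med b hb (medList b)).1 le_rfl
  rw [hlen]
  exact lt_of_lt_of_le h1 (aux_count ε _ h)

theorem aux_forall_ofFn {R : ℝ → ℝ → Prop} : ∀ {n : ℕ} (g h : Fin n → ℝ),
    (∀ i, R (g i) (h i)) → List.Forall₂ R (List.ofFn g) (List.ofFn h) := by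
  intro n
  induction n with
  | zero => intro g h _; simp
  | succ n ih =>
    intro g h H
    rw [List.ofFn_succ, List.ofFn_succ]
    exact List.Forall₂.cons (H 0) (ih _ _ fun i => H i.succ)

theorem aux_phMed_le {n m : ℕ} (f : Fin (n + 1) → ℝ → ℝ) (P Q : Fin n → Fin m → ℝ)
    (s t ε : ℝ) (j : Fin m) (hε : 0 ≤ ε) (h1 : ∀ k, f k s ≤ f k t + ε)
    (h2 : ∀ i, P i j ≤ Q i j) : phMed f P s j ≤ phMed f Q t j + ε := by
  unfold phMed
  apply aux_med_le
  · apply List.rel_append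
    · exact aux_forall_ofFn _ _ h1
    · exact aux_forall_ofFn _ _ fun i => by linarith [h2 i]
  · simp [List.ofFn_succ]

theorem aux_cont {n m : ℕ} (f : Fin (n + 1) → ℝ → ℝ) (hf : IsPhantomSystem n f)
    (P : Fin n → Fin m → ℝ) (j : Fin m) :
    ContinuousOn (fun t => phMed f P t j) (Set.Icc 0 1) := by
  intro t ht
  rw [ContinuousWithinAt, Metric.tendsto_nhds]
  intro ε hε
  have h : ∀ᶠ s in nhdsWithin t (Set.Icc 0 1), ∀ k, dist (f k s) (f k t) < ε / 2 := by
    rw [Filter.eventually_all]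
    intro k
    exact Metric.tendsto_nhds.1 (hf.cont k t ht) _ (by linarith)
  filter_upwards [h] with s hs
  rw [Real.dist_eq]
  have hs' : ∀ k, |f k s - f k t| < ε / 2 := fun k => by
    have := hs k
    rwa [Real.dist_eq] at this
  have a1 := aux_phMed_le f P P s t (ε / 2) j (by linarith)
    (fun k => by linarith [(abs_lt.1 (hs' k)).2]) (fun i => le_rfl)
  have a2 := aux_phMed_le f P P t s (ε / 2) j (by linarith)
    (fun k => by linarith [(abs_lt.1 (hs' k)).1]) (fun i => le_rfl)
  rw [abs_lt]
  constructor <;> linarith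

theorem aux_zero {n m : ℕ} (f : Fin (n + 1) → ℝ → ℝ) (hf : IsPhantomSystem n f)
    (P : Fin n → Fin m → ℝ) (j : Fin m) : phMed f P 0 j ≤ 0 := by
  unfold phMed
  rw [aux_med _ (by simp [List.ofFn_succ]), List.countP_append]
  have : (List.ofFn fun k => f k 0).countP (fun x => decide (x ≤ 0)) = n + 1 := by
    rw [List.countP_eq_length.2]
    · simp
    · intro x hx
      rw [List.mem_ofFn] at hx
      obtain ⟨k, rfl⟩ := hx
      simp [hf.apply_zero k]
  rw [this]
  simp only [List.length_append, List.length_ofFn]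
  omega

theorem aux_one {n m : ℕ} (f : Fin (n + 1) → ℝ → ℝ) (hf : IsPhantomSystem n f)
    (P : Fin n → Fin m → ℝ) (j : Fin m) : 1 ≤ phMed f P 1 j := by
  by_contra hc
  push Not at hc
  have h : phMed f P 1 j ≤ phMed f P 1 j := le_rfl
  generalize hcc : phMed f P 1 j = c at h hc
  have h : phMed f P 1 j ≤ c := hcc.le
  unfold phMed at h
  rw [aux_med _ (by simp [List.ofFn_succ]), List.countP_append] at h
  have h0 : (List.ofFn fun k => f k 1).countP (fun x => decide (x ≤ c)) = 0 := by
    rw [List.countP_eq_zero]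
    intro x hx
    rw [List.mem_ofFn] at hx
    obtain ⟨k, rfl⟩ := hx
    simp [hf.apply_one k, hc]
  have h1 := List.countP_le_length (p := fun x => decide (x ≤ c)) (l := List.ofFn fun i => P i j)
  rw [h0] at h
  simp only [List.length_append, List.length_ofFn] at h h1
  omega

theorem aux_tStar {n m : ℕ} (hm : 2 ≤ m) (f : Fin (n + 1) → ℝ → ℝ) (hf : IsPhantomSystem n f)
    (P : Fin n → Fin m → ℝ) :
    tStar f P ∈ Set.Icc (0 : ℝ) 1 ∧ ∑ j, phMed f P (tStar f P) j = 1 := by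
  have hcont : ContinuousOn (fun t => ∑ j, phMed f P t j) (Set.Icc 0 1) :=
    continuousOn_finsetSum _ fun j _ => aux_cont f hf P j
  have h0 : ∑ j, phMed f P 0 j ≤ 1 :=
    (Finset.sum_nonpos fun j _ => aux_zero f hf P j).trans zero_le_one
  have h1 : 1 ≤ ∑ j, phMed f P 1 j := by
    have : ∑ j : Fin m, (1 : ℝ) ≤ ∑ j, phMed f P 1 j :=
      Finset.sum_le_sum fun j _ => aux_one f hf P j
    simp at this
    have h2 : (2 : ℝ) ≤ m := by exact_mod_cast hm
    linarith
  have hne : {t | t ∈ Set.Icc (0 : ℝ) 1 ∧ ∑ j, phMed f P t j = 1}.Nonempty := by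
    obtain ⟨t, ht, h⟩ := intermediate_value_Icc (zero_le_one (α := ℝ)) hcont ⟨h0, h1⟩
    exact ⟨t, ht, h⟩
  have hcl : IsClosed {t | t ∈ Set.Icc (0 : ℝ) 1 ∧ ∑ j, phMed f P t j = 1} :=
    hcont.preimage_isClosed_of_isClosed isClosed_Icc (isClosed_singleton (x := (1 : ℝ)))
  exact hcl.csInf_mem hne ⟨0, fun t ht => ht.1.1⟩

theorem aux_mono {n m : ℕ} (f : Fin (n + 1) → ℝ → ℝ) (hf : IsPhantomSystem n f)
    (P Q : Fin n → Fin m → ℝ) (s t : ℝ) (hs : s ∈ Set.Icc (0 : ℝ) 1) (ht : t ∈ Set.Icc (0 : ℝ) 1)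
    (hst : s ≤ t) (j : Fin m) (h : ∀ i, P i j ≤ Q i j) : phMed f P s j ≤ phMed f Q t j := by
  have := aux_phMed_le f P Q s t 0 j le_rfl
    (fun k => by linarith [hf.mono k hs ht hst]) h
  linarith

/-- every moving phantom mechanism satisfies monotonicity: if a voter raises
her report on alternative `j` and weakly lowers it everywhere else, the aggregate on `j`
does not decrease. -/
theorem moving_phantom_monotone (n m : ℕ) (hn : 1 ≤ n) (hm : 2 ≤ m)
    (f : Fin (n + 1) → ℝ → ℝ) (hf : IsPhantomSystem n f)
    (P : Fin n → Fin m → ℝ) (hP : IsProfile P) (i : Fin n)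
    (p p' : Fin m → ℝ) (hp : IsDivision p) (hp' : IsDivision p')
    (j : Fin m) (hgt : p' j < p j) (hle : ∀ k, k ≠ j → p k ≤ p' k) :
    AMP f (Function.update P i p') j ≤ AMP f (Function.update P i p) j := by
  have hu : ∀ (q q' : Fin m → ℝ) (k : Fin m), q k ≤ q' k →
      ∀ l, Function.update P i q l k ≤ Function.update P i q' l k := by
    intro q q' k h l
    by_cases hl : l = i
    · subst hl; simpa using h
    · simp [Function.update_of_ne hl]
  obtain ⟨ht, hs⟩ := aux_tStar hm f hf (Function.update P i p)
  obtain ⟨ht', hs'⟩ := aux_tStar hm f hf (Function.update P i p')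
  unfold AMP
  rcases le_total (tStar f (Function.update P i p')) (tStar f (Function.update P i p)) with h | h
  · exact aux_mono f hf _ _ _ _ ht' ht h j (hu p' p j hgt.le)
  · rw [← Finset.add_sum_erase _ _ (Finset.mem_univ j)] at hs hs'
    have := Finset.sum_le_sum (s := Finset.univ.erase j) fun k hk =>
      aux_mono f hf _ _ _ _ ht ht' h k (hu p p' k (hle k (Finset.ne_of_mem_erase hk)))
    linarith
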